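/- arXiv:0712.4377 — 2 statements merged into one kernel-verified Lean document; each statement's English description precedes it below -/
import Mathlib

section
/- Dimension bound for similar subspaces. Let H be a finite-dimensional complex inner product space and let V, W ⊆ H be linear subspaces. Let ε > 0 be a real number with 4·ε·(dim V − 1)² ≤ 1, and suppose that for every unit vector v ∈ V there exists a unit vector w ∈ W with ‖v − w‖ ≤ ε. Then dim W ≥ dim V. -/
/-- **Dimension bound for similar subspaces.** Let `V, W` be subspaces of a
finite-dimensional complex inner product space, and let `ε > 0` satisfy
`4ε(dim V − 1)² ≤ 1`. If every unit vector of `V` is within distance `ε` of some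
unit vector of `W`, then `dim W ≥ dim V`. -/
theorem dimension_bound_similar_subspaces
    {H : Type*} [NormedAddCommGroup H] [InnerProductSpace ℂ H] [FiniteDimensional ℂ H]
    (V W : Submodule ℂ H) (ε : ℝ) (hε : 0 < ε)
    (hεdim : 4 * ε * ((Module.finrank ℂ V : ℝ) - 1) ^ 2 ≤ 1)
    (happrox : ∀ v ∈ V, ‖v‖ = 1 → ∃ w ∈ W, ‖w‖ = 1 ∧ ‖v - w‖ ≤ ε) :
    Module.finrank ℂ V ≤ Module.finrank ℂ W := by
  by_contra hlt
  push Not at hlt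
  by_cases h2 : 2 ≤ Module.finrank ℂ V
  · have hε4 : ε ≤ 1 / 4 := by
      have : (2 : ℝ) ≤ (Module.finrank ℂ V : ℝ) := by exact_mod_cast h2
      nlinarith [mul_nonneg hε.le (by nlinarith : (0 : ℝ) ≤ ((Module.finrank ℂ V : ℝ) - 1) ^ 2 - 1)]
    let f : V →ₗ[ℂ] W := (W.orthogonalProjection : H →ₗ[ℂ] W).comp V.subtype
    have hf : ¬ Function.Injective f := fun h =>
      absurd (LinearMap.finrank_le_finrank_of_injective h) (not_le.mpr hlt)
    rw [injective_iff_map_eq_zero] at hf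
    push Not at hf
    obtain ⟨⟨x, hxV⟩, hx0, hxne⟩ := hf
    have hxne' : x ≠ 0 := fun h => hxne (by simpa using h)
    have hxo : x ∈ Wᗮ := by
      rw [← Submodule.orthogonalProjection_eq_zero_iff]
      exact hx0
    have hn : ‖((‖x‖⁻¹ : ℝ) : ℂ) • x‖ = 1 := by
      rw [norm_smul]
      simp [hxne']
    obtain ⟨w, hwW, hw1, hd⟩ := happrox (((‖x‖⁻¹ : ℝ) : ℂ) • x) (V.smul_mem _ hxV) hn
    have hvo := Wᗮ.smul_mem ((‖x‖⁻¹ : ℝ) : ℂ) hxo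
    have hin := Submodule.inner_left_of_mem_orthogonal hwW hvo
    have hsq := @norm_sub_sq ℂ H _ _ _ (((‖x‖⁻¹ : ℝ) : ℂ) • x) w
    rw [hin, hn, hw1] at hsq
    simp only [map_zero] at hsq
    nlinarith [norm_nonneg ((((‖x‖⁻¹ : ℝ) : ℂ) • x) - w)]
  · have hW : Module.finrank ℂ W = 0 := by omega
    have hV : 0 < Module.finrank ℂ V := by omega
    have hWb : W = ⊥ := Submodule.finrank_eq_zero.mp hW
    have : Nontrivial V := Module.finrank_pos_iff.mp hV
    obtain ⟨⟨x, hxV⟩, hxne⟩ := exists_ne (0 : V)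
    have hxne' : x ≠ 0 := fun h => hxne (by simpa using h)
    have hn : ‖((‖x‖⁻¹ : ℝ) : ℂ) • x‖ = 1 := by
      rw [norm_smul]
      simp [hxne']
    obtain ⟨w, hwW, hw1, hd⟩ := happrox (((‖x‖⁻¹ : ℝ) : ℂ) • x) (V.smul_mem _ hxV) hn
    rw [hWb, Submodule.mem_bot] at hwW
    simp [hwW] at hw1
end

section
/- Near-identity isometry between similar subspaces. Let H be a finite-dimensional complex inner product space and let V, W ⊆ H be linear subspaces. Let ε > 0 satisfy 4·ε·(dim V − 1)² ≤ 1 and additionally ε ≤ (1/36)·(5/2)^{2 − 2·dim V}, and suppose that for every unit vector v ∈ V there exists a unit vector w ∈ W with ‖v − w‖ ≤ ε. Then there exists a linear isometry U : V → H with range contained in W such that ‖U v − v‖ ≤ (8/3)·√ε·(5/2)^{dim V}·‖v‖ for every v ∈ V. -/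
/-- **Near-identity isometry between similar subspaces.** Let `V, W` be subspaces of
a finite-dimensional complex inner product space and `ε > 0` with
`4ε(dim V − 1)² ≤ 1` and `ε ≤ (1/36)(5/2)^{2 − 2 dim V}`. If every unit vector of `V`
is within distance `ε` of some unit vector of `W`, then there is a linear isometry
`U : V → H` with range in `W` such that `‖U v − v‖ ≤ (8/3)√ε (5/2)^{dim V} ‖v‖`
for every `v ∈ V`. -/
theorem near_identity_isometry_similar_subspaces
    {H : Type*} [NormedAddCommGroup H] [InnerProductSpace ℂ H] [FiniteDimensional ℂ H]
    (V W : Submodule ℂ H) (ε : ℝ) (hε : 0 < ε)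
    (hεdim : 4 * ε * ((Module.finrank ℂ V : ℝ) - 1) ^ 2 ≤ 1)
    (hεsmall : ε ≤ (1 / 36) * ((5 : ℝ) / 2) ^ ((2 : ℤ) - 2 * (Module.finrank ℂ V : ℤ)))
    (happrox : ∀ v ∈ V, ‖v‖ = 1 → ∃ w ∈ W, ‖w‖ = 1 ∧ ‖v - w‖ ≤ ε) :
    ∃ U : V →ₗᵢ[ℂ] H, (∀ v : V, U v ∈ W) ∧
      ∀ v : V, ‖U v - (v : H)‖ ≤
        (8 / 3) * Real.sqrt ε * ((5 : ℝ) / 2) ^ (Module.finrank ℂ V) * ‖(v : H)‖ := by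
  have hdist : ∀ v : V, ‖W.starProjection (v : H) - v‖ ≤ ε * ‖(v : H)‖ := by
    intro v
    by_cases hv : (v : H) = 0
    · simp [hv]
    have hn : 0 < ‖(v : H)‖ := norm_pos_iff.mpr hv
    obtain ⟨w, hw, -, hvw⟩ := happrox (((‖(v : H)‖⁻¹ : ℝ) : ℂ) • (v : H))
      (V.smul_mem _ v.2) (by
        rw [norm_smul, Complex.norm_real, norm_inv, norm_norm, inv_mul_cancel₀ hn.ne'])
    set w' : H := ((‖(v : H)‖ : ℝ) : ℂ) • w with hw'
    have h1 : ‖(v : H) - w'‖ ≤ ε * ‖(v : H)‖ := by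
      have : (v : H) - w' = ((‖(v : H)‖ : ℝ) : ℂ) • ((((‖(v : H)‖⁻¹ : ℝ) : ℂ) • (v : H)) - w) := by
        rw [smul_sub, smul_smul, ← Complex.ofReal_mul, mul_inv_cancel₀ hn.ne']
        simp [hw']
      rw [this, norm_smul, Complex.norm_real, norm_norm, mul_comm]
      gcongr
    have hm : w' ∈ W := W.smul_mem _ hw
    have h2 : W.starProjection (v : H) - v
        = W.starProjection ((v : H) - w') - ((v : H) - w') := by
      rw [map_sub, Submodule.starProjection_eq_self_iff.mpr hm]
      abel
    have h3 : ‖(v : H) - W.starProjection (v : H)‖ ≤ ‖(v : H) - w'‖ := by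
      rw [Submodule.starProjection_minimal]
      exact ciInf_le ⟨0, by rintro _ ⟨x, rfl⟩; exact norm_nonneg _⟩ (⟨w', hm⟩ : W)
    rw [norm_sub_rev]
    exact h3.trans h1
  have hε1 : (Module.finrank ℂ V = 0) ∨ ε < 1 := by
    by_cases h0 : Module.finrank ℂ V = 0
    · exact Or.inl h0
    right
    have : ((5 : ℝ) / 2) ^ ((2 : ℤ) - 2 * (Module.finrank ℂ V : ℤ)) ≤ 1 :=
      zpow_le_one_of_nonpos₀ (by norm_num) (by omega)
    linarith
  obtain ⟨T, hT⟩ : ∃ T : V →ₗ[ℂ] H, ∀ v : V, T v = W.starProjection (v : H) :=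
    ⟨W.starProjection.toLinearMap ∘ₗ V.subtype, fun v => rfl⟩
  have hS : (LinearMap.adjoint T ∘ₗ T).IsSymmetric := T.isSymmetric_adjoint_comp_self
  obtain ⟨b, hb⟩ : ∃ b : OrthonormalBasis (Fin (Module.finrank ℂ V)) ℂ V, ∀ j, ∃ c : ℂ,
      (LinearMap.adjoint T ∘ₗ T) (b j) = c • b j :=
    ⟨hS.eigenvectorBasis rfl, fun j => ⟨_, hS.apply_eigenvectorBasis rfl j⟩⟩
  have hb1 : ∀ i, ‖((b i : V) : H)‖ = 1 := fun i => b.orthonormal.1 i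
  have horth : ∀ i j, i ≠ j → inner ℂ (T (b i)) (T (b j)) = 0 := by
    intro i j hij
    rw [← LinearMap.adjoint_inner_right]
    obtain ⟨c, this⟩ := hb j
    rw [LinearMap.comp_apply] at this
    rw [this, inner_smul_right, b.orthonormal.2 hij, mul_zero]
  have hεlt : ∀ _ : Fin (Module.finrank ℂ V), ε < 1 := by
    intro i
    rcases hε1 with h | h
    · have := i.2
      omega
    · exact h
  have htb : ∀ i, |1 - ‖T (b i)‖| ≤ ε := by
    intro i
    have h1 := hdist (b i)
    rw [hb1, mul_one, norm_sub_rev] at h1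
    have h2 := abs_norm_sub_norm_le ((b i : V) : H) (T (b i))
    rw [hb1, hT] at h2
    rw [hT]
    exact h2.trans h1
  have htpos : ∀ i, 0 < ‖T (b i)‖ := by
    intro i
    have h1 := abs_le.mp (htb i)
    have h2 := hεlt i
    linarith [h1.2]
  let u : Fin (Module.finrank ℂ V) → H := fun i => ((‖T (b i)‖⁻¹ : ℝ) : ℂ) • T (b i)
  have hu : Orthonormal ℂ u := by
    constructor
    · intro i
      simp only [u]
      rw [norm_smul, Complex.norm_real, norm_inv, norm_norm, inv_mul_cancel₀ (htpos i).ne']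
    · intro i j hij
      simp only [u]
      rw [inner_smul_left, inner_smul_right, horth i j hij]
      simp
  obtain ⟨U, hU⟩ : ∃ U : V →ₗᵢ[ℂ] H, ∀ i, U (b i) = u i := by
    have hU0 : ∀ i, (b.toBasis.constr ℂ u) (b i) = u i := by
      intro i
      have := b.toBasis.constr_basis ℂ u i
      rwa [OrthonormalBasis.coe_toBasis] at this
    refine ⟨(b.toBasis.constr ℂ u).isometryOfOrthonormal (v := b.toBasis)
      (by rw [OrthonormalBasis.coe_toBasis]; exact b.orthonormal) ?_, hU0⟩
    have : (⇑(b.toBasis.constr ℂ u) ∘ ⇑b.toBasis) = u := by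
      funext i
      rw [OrthonormalBasis.coe_toBasis]
      exact hU0 i
    rw [this]; exact hu
  have huT : ∀ i, T (b i) = ((‖T (b i)‖ : ℝ) : ℂ) • u i := by
    intro i
    simp only [u]
    rw [smul_smul, ← Complex.ofReal_mul, mul_inv_cancel₀ (htpos i).ne']
    simp
  refine ⟨U, ?_, ?_⟩
  · intro v
    rw [← b.sum_repr v, map_sum]
    refine W.sum_mem fun i _ => ?_
    rw [map_smul, hU]
    simp only [u, hT]
    exact W.smul_mem _ (W.smul_mem _ (Submodule.starProjection_apply_mem _ _))
  · intro v
    let x : V := ∑ i, (((1 - ‖T (b i)‖ : ℝ) : ℂ) * b.repr v i) • b i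
    have hx : U v - T v = U x := by
      have e1 : U v = ∑ i, b.repr v i • u i := by
        conv_lhs => rw [← b.sum_repr v, map_sum]
        simp only [map_smul, hU]
      have e2 : T v = ∑ i, b.repr v i • (((‖T (b i)‖ : ℝ) : ℂ) • u i) := by
        conv_lhs => rw [← b.sum_repr v, map_sum]
        refine Finset.sum_congr rfl fun i _ => ?_
        rw [map_smul, ← huT]
      rw [e1, e2, map_sum, ← Finset.sum_sub_distrib]
      refine Finset.sum_congr rfl fun i _ => ?_
      rw [map_smul, hU]
      generalize u i = z
      rw [smul_smul, ← sub_smul]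
      congr 1
      push_cast
      ring
    have hxr : ∀ i, b.repr x i = ((1 - ‖T (b i)‖ : ℝ) : ℂ) * b.repr v i := by
      intro i
      rw [b.repr_apply_apply]
      exact b.orthonormal.inner_right_fintype _ i
    have hxn : ‖x‖ ≤ ε * ‖v‖ := by
      refine (sq_le_sq₀ (norm_nonneg _) (by positivity)).mp ?_
      rw [mul_pow, ← b.sum_sq_norm_inner_right x, ← b.sum_sq_norm_inner_right v, Finset.mul_sum]
      refine Finset.sum_le_sum fun i _ => ?_
      rw [← b.repr_apply_apply, ← b.repr_apply_apply, hxr, norm_mul, mul_pow, Complex.norm_real,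
        Real.norm_eq_abs]
      gcongr
      exact htb i
    have h1 : ‖U v - (v : H)‖ ≤ 2 * ε * ‖(v : H)‖ := by
      have h2 : U v - (v : H) = U x + (W.starProjection (v : H) - v) := by
        rw [← hx, hT]; abel
      rw [h2]
      refine (norm_add_le _ _).trans ?_
      rw [U.norm_map]
      have := hdist v
      have h5 : ‖v‖ = ‖(v : H)‖ := rfl
      rw [h5] at hxn
      linarith
    refine h1.trans ?_
    gcongr ?_ * _
    have hε2 : ε ≤ 1 := by
      have : ((5 : ℝ) / 2) ^ ((2 : ℤ) - 2 * (Module.finrank ℂ V : ℤ)) ≤ (5 / 2) ^ (2 : ℤ) :=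
        zpow_le_zpow_right₀ (by norm_num) (by omega)
      norm_num at this
      linarith
    have hs : ε ≤ Real.sqrt ε := Real.le_sqrt_of_sq_le (by nlinarith)
    have hp : (1 : ℝ) ≤ (5 / 2) ^ (Module.finrank ℂ V) := one_le_pow₀ (by norm_num)
    nlinarith [mul_le_mul hs hp zero_le_one (Real.sqrt_nonneg ε)]
end
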